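/- Every one-dimensional lattice-gas model with finite-range interactions has a periodic ground-state configuration: for every finite set S, every R ≥ 1 and every f : (Fin R → S) → ℝ, there exist a configuration X : ℤ → S and a period p ≥ 1 with X(i+p) = X(i) for all i ∈ ℤ, such that X is a ground-state configuration of f. -/

import Mathlib

/-- The window of the configuration `X : ℤ → S` at site `i`: `(X(i), X(i+1), …, X(i+R−1))`. -/
def window {S : Type*} {R : ℕ} (X : ℤ → S) (i : ℤ) : Fin R → S :=
  fun k => X (i + (k : ℤ))

/-- `Y` is a local excitation of `X`: they differ at finitely many sites. -/
def LocalExc {S : Type*} (Y X : ℤ → S) : Prop := {i : ℤ | Y i ≠ X i}.Finite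

/-- `X` is a ground-state configuration of the finite-range interaction `f`:
the relative Hamiltonian `H(Y|X) = Σ_i [f(window of Y at i) − f(window of X at i)]`
(a finite sum for `Y ∼ X`) is nonnegative for every local excitation `Y` of `X`. -/
def IsGroundState {S : Type*} {R : ℕ} (f : (Fin R → S) → ℝ) (X : ℤ → S) : Prop :=
  ∀ Y : ℤ → S, LocalExc Y X →
    0 ≤ ∑ᶠ i : ℤ, (f (window Y i) - f (window X i))

/-- The energy of the first `n` windows of `X` starting at site `0`. -/
noncomputable def energy {S : Type*} {R : ℕ} (f : (Fin R → S) → ℝ) (X : ℤ → S) (n : ℕ) : ℝ :=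
  ∑ i ∈ Finset.range n, f (window X (i : ℤ))

theorem window_congr {S : Type*} {R : ℕ} {X Y : ℤ → S} {i j : ℤ}
    (h : ∀ k : ℤ, 0 ≤ k → k < R → X (i + k) = Y (j + k)) :
    (window X i : Fin R → S) = window Y j := by
  funext k
  exact h k (by positivity) (by exact_mod_cast k.2)

theorem eq_of_window_eq {S : Type*} {R : ℕ} {X Y : ℤ → S} {i j : ℤ}
    (h : (window X i : Fin R → S) = window Y j) {k : ℤ} (h0 : 0 ≤ k) (hk : k < R) :
    X (i + k) = Y (j + k) := by
  have := congrFun h ⟨k.toNat, by omega⟩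
  simpa [window, h0] using this

theorem window_comp_add {S : Type*} {R : ℕ} (X : ℤ → S) (a i : ℤ) :
    (window (fun t => X (t + a)) i : Fin R → S) = window X (i + a) :=
  window_congr fun k _ _ => congrArg X (by ring)

theorem energy_congr {S : Type*} {R : ℕ} (f : (Fin R → S) → ℝ) {X Y : ℤ → S} {n : ℕ}
    (h : ∀ i : ℕ, i < n → (window X i : Fin R → S) = window Y i) :
    energy f X n = energy f Y n :=
  Finset.sum_congr rfl fun i hi => by rw [h i (Finset.mem_range.1 hi)]

theorem energy_add {S : Type*} {R : ℕ} (f : (Fin R → S) → ℝ) (X : ℤ → S) (m n : ℕ) :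
    energy f X (m + n) = energy f X m + energy f (fun t => X (t + m)) n := by
  simp only [energy, Finset.sum_range_add, window_comp_add]
  push_cast
  simp only [add_comm]

theorem energy_mul_of_periodic {S : Type*} {R : ℕ} (f : (Fin R → S) → ℝ) {X : ℤ → S} {p : ℕ}
    (hX : ∀ i : ℤ, X (i + p) = X i) (n : ℕ) :
    energy f X (p * n) = n * energy f X p := by
  induction n with
  | zero => simp [energy]
  | succ n ih =>
    rw [Nat.mul_succ, add_comm, energy_add]
    simp only [hX, ih]
    push_cast
    ring

/-- A segment of length `d` whose end window repeats its initial window has the same windows as its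
periodic extension. -/
theorem window_emod_eq {S : Type*} {R : ℕ} {W : ℤ → S} {d : ℕ}
    (hW : (window W 0 : Fin R → S) = window W d) {i : ℕ} (hi : i < d) :
    (window (fun t => W (t % d)) i : Fin R → S) = window W i := by
  have key : ∀ t : ℕ, t < d + R → W ((t : ℤ) % d) = W t := by
    intro t
    induction t using Nat.strong_induction_on with
    | _ t ih =>
      intro ht
      rcases lt_or_ge t d with h | h
      · rw [Int.emod_eq_of_lt (by positivity) (by exact_mod_cast h)]
      · obtain ⟨s, rfl⟩ := Nat.exists_eq_add_of_le h
        have h1 := ih s (by omega) (by omega)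
        have h2 := eq_of_window_eq hW (k := (s : ℤ)) (by positivity) (by omega)
        push_cast
        rw [Int.add_emod_left, h1, ← h2, zero_add]
  refine window_congr fun k h0 hk => ?_
  have := key (i + k.toNat) (by omega)
  push_cast at this
  rwa [Int.toNat_of_nonneg h0] at this

/-- Excising the part of a walk between two occurrences of the same window splits the energy. -/
theorem exists_excision {S : Type*} {R : ℕ} (f : (Fin R → S) → ℝ) {W : ℤ → S} {i l r : ℕ}
    (hW : (window W 0 : Fin R → S) = window W ((i + l + r : ℕ) : ℤ))
    (h : (window W (i : ℤ) : Fin R → S) = window W ((i + l : ℕ) : ℤ)) :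
    ∃ V : ℤ → S, (window V 0 : Fin R → S) = window V ((i + r : ℕ) : ℤ) ∧
      energy f W (i + l + r) = energy f (fun t => W (t + i)) l + energy f V (i + r) := by
  let V : ℤ → S := fun t => if t < i then W t else W (t + l)
  have hlow : ∀ k : ℕ, k ≤ i → (window V k : Fin R → S) = window W k := by
    intro k hk
    refine window_congr fun s h0 hs => ?_
    by_cases hlt : (k : ℤ) + s < i
    · simp [V, hlt]
    · have := eq_of_window_eq h (k := k + s - i) (by omega) (by omega)
      simp only [V, if_neg hlt]
      push_cast at this
      convert this.symm using 2 <;> ring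
  have hhigh : ∀ k : ℕ, (window V ((i + k : ℕ) : ℤ) : Fin R → S) =
      window W ((i + l + k : ℕ) : ℤ) := by
    intro k
    refine window_congr fun s h0 hs => ?_
    simp only [V, if_neg (show ¬ ((i + k : ℕ) : ℤ) + s < i by omega)]
    congr 1
    push_cast
    ring
  refine ⟨V, ?_, ?_⟩
  · rw [hhigh, ← hW]
    exact_mod_cast hlow 0 (Nat.zero_le i)
  · have h1 : energy f V i = energy f W i := energy_congr f fun k hk => hlow k hk.le
    have h2 : energy f (fun t => V (t + i)) r = energy f (fun t => W (t + (i + l : ℕ))) r := by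
      refine energy_congr f fun k _ => ?_
      rw [window_comp_add, window_comp_add]
      convert hhigh k using 2 <;> push_cast <;> ring
    rw [energy_add, energy_add, energy_add f V, h1, h2]
    ring

/-- The minimal mean energy of closed walks is attained by a periodic configuration. -/
theorem exists_periodic_min_mean_energy {S : Type*} [Finite S] [Nonempty S] {R : ℕ}
    (f : (Fin R → S) → ℝ) :
    ∃ (X : ℤ → S) (p : ℕ) (m : ℝ), 1 ≤ p ∧ (∀ i : ℤ, X (i + p) = X i) ∧ energy f X p = m * p ∧
      ∀ (d : ℕ) (W : ℤ → S), 1 ≤ d → (window W 0 : Fin R → S) = window W d →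
        m * d ≤ energy f W d := by
  classical
  have := Fintype.ofFinite S
  set N := Fintype.card (Fin R → S) with hN
  have hNpos : 0 < N := Fintype.card_pos
  have : Nonempty (Fin N) := ⟨⟨0, hNpos⟩⟩
  let per : Fin N × (Fin N → S) → ℤ → S := fun a t =>
    a.2 ⟨(t % (a.1 + 1 : ℕ)).toNat, by
      have h1 := Int.emod_lt_of_pos t (show (0 : ℤ) < (a.1 + 1 : ℕ) by positivity)
      have := a.1.2
      omega⟩
  obtain ⟨a, ha⟩ := Finite.exists_min fun a : Fin N × (Fin N → S) =>
    energy f (per a) (a.1 + 1) / (a.1 + 1 : ℕ)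
  refine ⟨per a, a.1 + 1, energy f (per a) (a.1 + 1) / (a.1 + 1 : ℕ), by omega, ?_, ?_, ?_⟩
  · intro i
    simp only [per, Int.add_emod_right]
  · field_simp
  · intro d
    induction d using Nat.strong_induction_on with
    | _ d ih =>
      intro W hd hW
      rcases le_or_gt d N with hdN | hdN
      · obtain ⟨q, rfl⟩ := Nat.exists_eq_add_of_le' hd
        have hmin := ha (⟨q, hdN⟩, fun k => W k)
        have hE : energy f (per (⟨q, hdN⟩, fun k => W k)) (q + 1) = energy f W (q + 1) := by
          refine energy_congr f fun i hi => ?_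
          rw [← window_emod_eq hW hi]
          refine window_congr fun k _ _ => congrArg W ?_
          exact Int.toNat_of_nonneg (Int.emod_nonneg _ (by positivity))
        dsimp only at hmin
        rw [hE] at hmin
        rwa [← le_div_iff₀ (by positivity)]
      · obtain ⟨x, y, hxy, hw⟩ := Fintype.exists_ne_map_eq_of_card_lt
          (fun i : Fin d => (window W ((i : ℕ) : ℤ) : Fin R → S)) (by simpa only [Fintype.card_fin] using hdN)
        wlog hlt : x < y generalizing x y
        · exact this y x hxy.symm hw.symm (lt_of_le_of_ne (not_lt.1 hlt) hxy.symm)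
        obtain ⟨i, hi⟩ := x
        obtain ⟨j, hj⟩ := y
        simp only [Fin.mk_lt_mk] at hlt
        obtain ⟨l, rfl⟩ := Nat.exists_eq_add_of_le hlt.le
        obtain ⟨r, rfl⟩ := Nat.exists_eq_add_of_le hj.le
        obtain ⟨V, hV, hE⟩ := exists_excision f hW hw
        have h1 := ih l (by omega) (fun t => W (t + i)) (by omega) (by
          rw [window_comp_add, window_comp_add, zero_add, add_comm (l : ℤ)]
          exact_mod_cast hw)
        have h2 := ih (i + r) (by omega) V (by omega) hV
        rw [hE]
        refine le_trans (le_of_eq ?_) (add_le_add h1 h2)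
        push_cast
        ring

theorem exists_nat_bound_of_finite {D : Set ℤ} (hD : D.Finite) :
    ∃ B : ℕ, ∀ i ∈ D, |i| ≤ B := by
  obtain ⟨b, hb⟩ := (hD.image fun i => |i|).bddAbove
  exact ⟨b.toNat, fun i hi => (hb ⟨i, hi, rfl⟩).trans (Int.self_le_toNat b)⟩

/-- Every one-dimensional lattice-gas model with finite-range interactions
has a periodic ground-state configuration. -/
theorem exists_periodic_ground_state_one_dim
    (S : Type*) [Fintype S] [Nonempty S]
    (R : ℕ) (hR : 1 ≤ R) (f : (Fin R → S) → ℝ) :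
    ∃ X : ℤ → S, ∃ p : ℤ, 1 ≤ p ∧ (∀ i : ℤ, X (i + p) = X i) ∧ IsGroundState f X := by
  obtain ⟨X, p, m, hp, hX, hE, hmin⟩ := exists_periodic_min_mean_energy f
  refine ⟨X, p, by exact_mod_cast hp, hX, fun Y hY => ?_⟩
  obtain ⟨B, hB⟩ := exists_nat_bound_of_finite hY
  have hYX : ∀ i : ℤ, (B : ℤ) < |i| → Y i = X i := fun i hi => by
    by_contra h
    exact absurd (hB i h) (not_le.2 hi)
  set n := B + R + 1 with hn
  set K := p * n with hK
  have hKB : B + R + 1 ≤ K := Nat.le_mul_of_pos_left _ hp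
  have hper : ∀ (c : ℕ) (i : ℤ), X (i + (p * c : ℕ)) = X i := by
    intro c i
    have := (show Function.Periodic X (p : ℤ) from hX).nat_mul c i
    rwa [mul_comm, Nat.cast_mul]
  have hsupp : (Function.support fun i : ℤ => f (window Y i) - f (window X i)) ⊆
      ((Finset.range (p * (2 * n))).image fun i : ℕ => (i : ℤ) + -K : Finset ℤ) := by
    intro i hi
    have hKn : p * (2 * n) = 2 * K := by rw [hK]; ring
    by_contra hmem
    refine hi (sub_eq_zero.2 (congrArg f (window_congr fun k h0 hk => hYX _ ?_)))
    have hout : i < -K ∨ (K : ℤ) ≤ i := by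
      by_contra! hcon
      refine hmem (Finset.mem_coe.2 (Finset.mem_image.2 ⟨(i + K).toNat, ?_, ?_⟩))
      · rw [Finset.mem_range]; omega
      · omega
    rw [lt_abs]
    omega
  have hsum : ∑ᶠ i : ℤ, (f (window Y i) - f (window X i)) =
      energy f (fun t => Y (t + -K)) (p * (2 * n)) -
        energy f (fun t => X (t + -K)) (p * (2 * n)) := by
    rw [finsum_eq_sum_of_support_subset _ hsupp,
      Finset.sum_image (fun a _ b _ hab => by simpa using hab), Finset.sum_sub_distrib]
    simp only [energy, window_comp_add]
  have hXshift : (fun t => X (t + -K)) = X := by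
    funext t
    rw [← hper n (t + -K), ← hK, neg_add_cancel_right]
  have hclosed := hmin (p * (2 * n)) (fun t => Y (t + -K))
    (Nat.one_le_iff_ne_zero.2 (by positivity)) (by
      refine window_congr fun k h0 hk => ?_
      have hKn : ((p * (2 * n) : ℕ) : ℤ) = 2 * K := by rw [hK]; push_cast; ring
      rw [hYX _ (by rw [lt_abs]; omega), hYX _ (by rw [lt_abs]; omega), ← hper (2 * n)]
      congr 1
      ring)
  rw [hsum, hXshift, energy_mul_of_periodic f hX, hE, sub_nonneg]
  refine le_trans (le_of_eq ?_) hclosed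
  push_cast
  ring
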